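/- Let R be a Noetherian commutative ring, N a finitely generated R-module, and I an ideal of R that is not contained in any minimal prime ideal over Ann_R N. Then the sequence of sets Ass_R (I^n)^{(N)}_a/(I^n)_a, n = 1, 2, …, is increasing and ultimately constant. -/

import Mathlib

open Pointwise

section Defs

variable {R : Type} [CommRing R]

/-- `x` is integrally dependent on the ideal `I` relative to the module `N`:
`x ^ n • N ⊆ ∑_{i=1}^n x^(n-i) • (I^i • N)` for some `n ≥ 1`. -/
def Ideal.RelIntDep (I : Ideal R) (N : Type) [AddCommGroup N] [Module R N] (x : R) : Prop :=
  ∃ n : ℕ, 0 < n ∧ ∀ m : N, x ^ n • m ∈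
    ⨆ i ∈ Finset.Icc 1 n, x ^ (n - i) • (I ^ i • (⊤ : Submodule R N))

/-- The integral closure `I^{(N)}_a` of `I` relative to `N`, as a subset of `R`. -/
def Ideal.relIntClosure (I : Ideal R) (N : Type) [AddCommGroup N] [Module R N] : Set R :=
  {x | I.RelIntDep N x}

/-- The classical integral closure `I_a` of an ideal, as a subset of `R`. -/
def Ideal.intClosure (I : Ideal R) : Set R :=
  {x | ∃ n : ℕ, 0 < n ∧ ∃ r : ℕ → R, (∀ i ∈ Finset.Icc 1 n, r i ∈ I ^ i) ∧
    x ^ n + ∑ i ∈ Finset.Icc 1 n, r i * x ^ (n - i) = 0}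

/-- `mAss_R N`: the set of minimal members of `Ass_R N`. -/
def mAss (R : Type) [CommRing R] (N : Type) [AddCommGroup N] [Module R N] : Set (Ideal R) :=
  {p | Minimal (· ∈ associatedPrimes R N) p}

/-- `Ass_R (R/J)` for a subset `J ⊆ R`: primes of the form `(J :_R x)`. -/
def assQuot (J : Set R) : Set (Ideal R) :=
  {p | p.IsPrime ∧ ∃ x : R, (p : Set R) = {r : R | r * x ∈ J}}

/-- `Ass_R (J/K)` for subsets `K ⊆ J` of `R`: primes of the form `(K :_R x)` with `x ∈ J`. -/
def assQuot₂ (J K : Set R) : Set (Ideal R) :=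
  {p | p.IsPrime ∧ ∃ x ∈ J, (p : Set R) = {r : R | r * x ∈ K}}

/-- `S(J) = ∪_{s ∈ S} (J :_R s)`. -/
def sat (S : Set R) (J : Set R) : Set R := {x | ∃ s ∈ S, s * x ∈ J}

/-- `(J :_R K)` for subsets of `R`. -/
def setColon (J K : Set R) : Set R := {x | ∀ y ∈ K, x * y ∈ J}

/-- `(J :_R ⟨K⟩) = ∪_{n ≥ 1} (J :_R K^n)`. -/
def colonPow (J : Set R) (K : Ideal R) : Set R :=
  {x | ∃ n : ℕ, 0 < n ∧ ∀ y ∈ K ^ n, x * y ∈ J}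

end Defs

namespace Ideal

variable {R : Type} [CommRing R]

theorem sup_span_singleton_pow (J : Ideal R) (x : R) (e : ℕ) :
    (J ⊔ span {x}) ^ e ≤ ⨆ i ∈ Finset.range (e + 1), J ^ i * span {x ^ (e - i)} := by
  rw [← Submodule.add_eq_sup, add_pow, Ideal.sum_eq_sup, Finset.sup_eq_iSup]
  refine iSup₂_mono fun i _ ↦ ?_
  rw [span_singleton_pow]
  exact mul_le_left

theorem mem_intClosure_iff {J : Ideal R} {x : R} :
    x ∈ J.intClosure ↔ ∃ e, x ^ (e + 1) ∈ J * (J ⊔ span {x}) ^ e := by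
  constructor
  · rintro ⟨n, hn, r, hr, h⟩
    obtain ⟨e, rfl⟩ : ∃ e, n = e + 1 := ⟨n - 1, by omega⟩
    refine ⟨e, ?_⟩
    rw [eq_neg_of_add_eq_zero_left h]
    refine (Submodule.neg_mem_iff _).2 (sum_mem _ fun i hi ↦ ?_)
    have hi' := Finset.mem_Icc.1 hi
    obtain ⟨j, rfl⟩ : ∃ j, i = j + 1 := ⟨i - 1, by omega⟩
    have h1 : r (j + 1) * x ^ (e + 1 - (j + 1)) ∈ J ^ (j + 1) * (J ⊔ span {x}) ^ (e - j) := by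
      rw [Nat.add_sub_add_right]
      exact mul_mem_mul (hr _ hi) (pow_mem_pow (mem_sup_right (mem_span_singleton_self x)) _)
    have h2 : J ^ (j + 1) * (J ⊔ span {x}) ^ (e - j) ≤ J * (J ⊔ span {x}) ^ e := by
      calc J ^ (j + 1) * (J ⊔ span {x}) ^ (e - j)
          = J * (J ^ j * (J ⊔ span {x}) ^ (e - j)) := by ring
        _ ≤ J * ((J ⊔ span {x}) ^ j * (J ⊔ span {x}) ^ (e - j)) := by
            gcongr; exact le_sup_left
        _ = J * (J ⊔ span {x}) ^ e := by rw [← pow_add]; congr 2; omega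
    exact h2 h1
  · rintro ⟨e, h⟩
    have h1 : J * (J ⊔ span {x}) ^ e ≤
        ⨆ i ∈ Finset.Icc 1 (e + 1), J ^ i * span {x ^ (e + 1 - i)} := by
      refine (mul_mono_right (sup_span_singleton_pow J x e)).trans ?_
      simp only [mul_iSup]
      refine iSup₂_le fun i hi ↦ ?_
      have hi' := Finset.mem_range.1 hi
      refine le_trans ?_ (le_iSup₂_of_le (i + 1) (by simp; omega) le_rfl)
      rw [← mul_assoc, ← pow_succ', Nat.add_sub_add_right]
    obtain ⟨μ, hμ⟩ := (Submodule.mem_iSup_finset_iff_exists_sum _ _).1 (h1 h)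
    choose r hr hr' using fun i ↦ mem_mul_span_singleton.1 (μ i).2
    refine ⟨e + 1, e.succ_pos, fun i ↦ - r i, fun i _ ↦ (Submodule.neg_mem_iff _).2 (hr i), ?_⟩
    simp only [neg_mul, hr', Finset.sum_neg_distrib, hμ, add_neg_cancel]

theorem sup_span_singleton_pow_succ_le {J : Ideal R} {x : R} {e : ℕ}
    (h : x ^ (e + 1) ∈ J * (J ⊔ span {x}) ^ e) :
    (J ⊔ span {x}) ^ (e + 1) ≤ J * (J ⊔ span {x}) ^ e := by
  refine (sup_span_singleton_pow J x (e + 1)).trans (iSup₂_le fun i hi ↦ ?_)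
  have hi' := Finset.mem_range.1 hi
  rcases i with _ | i
  · simpa [span_singleton_le_iff_mem] using h
  · calc J ^ (i + 1) * span {x ^ (e + 1 - (i + 1))}
        = J * (J ^ i * span {x} ^ (e - i)) := by
          rw [Nat.add_sub_add_right, span_singleton_pow]; ring
      _ ≤ J * ((J ⊔ span {x}) ^ i * (J ⊔ span {x}) ^ (e - i)) := by
          gcongr
          · exact le_sup_left
          · exact le_sup_right
      _ = J * (J ⊔ span {x}) ^ e := by rw [← pow_add]; congr 2; omega

/-- `J` is a reduction of `L`. -/
def IsReductionOf (J L : Ideal R) : Prop := J ≤ L ∧ ∃ e, L ^ (e + 1) ≤ J * L ^ e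

theorem IsReductionOf.pow_add_le {J L : Ideal R} {e : ℕ} (h : L ^ (e + 1) ≤ J * L ^ e) (k : ℕ) :
    L ^ (e + k) ≤ J ^ k * L ^ e := by
  induction k with
  | zero => simp
  | succ k ih =>
    calc L ^ (e + (k + 1)) = L * L ^ (e + k) := by ring
      _ ≤ L * (J ^ k * L ^ e) := by gcongr
      _ = J ^ k * L ^ (e + 1) := by ring
      _ ≤ J ^ k * (J * L ^ e) := by gcongr
      _ = J ^ (k + 1) * L ^ e := by ring

theorem IsReductionOf.trans {J L M : Ideal R} (h : J.IsReductionOf L) (h' : L.IsReductionOf M) :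
    J.IsReductionOf M := by
  obtain ⟨hJL, a, ha⟩ := h
  obtain ⟨hLM, b, hb⟩ := h'
  refine ⟨hJL.trans hLM, a + b, ?_⟩
  calc M ^ (a + b + 1) = M ^ (b + (a + 1)) := by ring_nf
    _ ≤ L ^ (a + 1) * M ^ b := IsReductionOf.pow_add_le hb _
    _ ≤ J * L ^ a * M ^ b := by gcongr
    _ ≤ J * M ^ a * M ^ b := by gcongr
    _ = J * M ^ (a + b) := by ring

theorem intClosure_mono {J L : Ideal R} (h : J ≤ L) : J.intClosure ⊆ L.intClosure := by
  intro x hx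
  obtain ⟨e, he⟩ := mem_intClosure_iff.1 hx
  have hle : J * (J ⊔ span {x}) ^ e ≤ L * (L ⊔ span {x}) ^ e := by gcongr
  exact mem_intClosure_iff.2 ⟨e, hle he⟩

theorem isReductionOf_sup_span {J : Ideal R} (s : Finset R) (hs : ∀ x ∈ s, x ∈ J.intClosure) :
    J.IsReductionOf (J ⊔ span s) := by
  classical
  induction s using Finset.induction_on with
  | empty => exact ⟨le_sup_left, 0, by simp⟩
  | insert x s _ ih =>
    have h1 := ih fun y hy ↦ hs y (Finset.mem_insert_of_mem hy)
    have hx := intClosure_mono (le_sup_left : J ≤ J ⊔ span s) (hs x (Finset.mem_insert_self x s))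
    obtain ⟨e, he⟩ := mem_intClosure_iff.1 hx
    have h2 : (J ⊔ span s).IsReductionOf (J ⊔ span s ⊔ span {x}) :=
      ⟨le_sup_left, e, sup_span_singleton_pow_succ_le he⟩
    convert h1.trans h2 using 1
    rw [Finset.coe_insert, span_insert, sup_assoc, sup_comm (span {x})]

theorem exists_pow_mem_of_mem_intClosure {J : Ideal R} {x : R} (hx : x ∈ J.intClosure) :
    ∃ c, ∀ k, x ^ k ∈ J ^ (k - c) := by
  obtain ⟨e, he⟩ := mem_intClosure_iff.1 hx
  refine ⟨e, fun k ↦ ?_⟩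
  rcases le_total k e with hk | hk
  · simp [Nat.sub_eq_zero_of_le hk]
  · obtain ⟨j, rfl⟩ := Nat.exists_eq_add_of_le hk
    rw [Nat.add_sub_cancel_left]
    exact mul_le_left (IsReductionOf.pow_add_le (sup_span_singleton_pow_succ_le he) j
      (pow_mem_pow (mem_sup_right (mem_span_singleton_self x)) _))

/-- The `J`-filtration equal to `R` in degrees up to `c`, and to `J ^ (k - c)` afterwards. -/
def shiftedAdicFiltration (J : Ideal R) (c : ℕ) : J.Filtration R where
  N k := J ^ (k - c)
  mono k := pow_le_pow_right (by omega)
  smul_le k := by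
    rw [smul_eq_mul, ← pow_succ']
    exact pow_le_pow_right (by omega)

/-- The filtration by the powers of an ideal `L`, as a `J`-filtration for `J ≤ L`. -/
def powFiltration {J L : Ideal R} (h : J ≤ L) : J.Filtration R where
  N k := L ^ k
  mono k := pow_le_pow_right k.le_succ
  smul_le k := by
    rw [smul_eq_mul, pow_succ']
    exact mul_mono_left h

theorem mem_intClosure_of_pow_mem [IsNoetherianRing R] {J : Ideal R} {x : R} {c : ℕ}
    (h : ∀ k, x ^ k ∈ J ^ (k - c)) : x ∈ J.intClosure := by
  have h1 : (J.shiftedAdicFiltration c).Stable := by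
    refine ⟨c, fun n hn ↦ ?_⟩
    change J • J ^ (n - c) = J ^ (n + 1 - c)
    rw [smul_eq_mul, ← pow_succ', Nat.sub_add_comm hn]
  have h2 : powFiltration (le_sup_left : J ≤ J ⊔ span {x}) ≤ J.shiftedAdicFiltration c := by
    intro k
    change (J ⊔ span {x}) ^ k ≤ J ^ (k - c)
    refine (sup_span_singleton_pow J x k).trans (iSup₂_le fun i hi ↦ ?_)
    calc J ^ i * span {x ^ (k - i)} ≤ J ^ i * J ^ (k - i - c) := by
          gcongr
          exact (span_singleton_le_iff_mem _).2 (h _)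
      _ = J ^ (i + (k - i - c)) := (pow_add _ _ _).symm
      _ ≤ J ^ (k - c) := pow_le_pow_right (by omega)
  obtain ⟨n, hn⟩ := h1.of_le h2
  refine mem_intClosure_iff.2 ⟨n, ?_⟩
  exact (hn n le_rfl).ge (pow_mem_pow (mem_sup_right (mem_span_singleton_self x)) _)

theorem mem_intClosure_of_isNilpotent {J : Ideal R} {x : R} (hx : IsNilpotent x) :
    x ∈ J.intClosure := by
  obtain ⟨e, he⟩ := hx
  exact mem_intClosure_iff.2 ⟨e, by simp [pow_succ, he]⟩

theorem mul_mem_intClosure {J : Ideal R} (r : R) {x : R} (hx : x ∈ J.intClosure) :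
    r * x ∈ J.intClosure := by
  obtain ⟨n, hn, a, ha, h⟩ := hx
  refine ⟨n, hn, fun i ↦ r ^ i * a i, fun i hi ↦ mul_mem_left _ _ (ha i hi), ?_⟩
  rw [← mul_zero (r ^ n), ← h, mul_add, mul_pow, Finset.mul_sum]
  congr 1
  refine Finset.sum_congr rfl fun i hi ↦ ?_
  rw [mul_pow, ← pow_mul_pow_sub r (Finset.mem_Icc.1 hi).2]
  ring

theorem mul_mem_intClosure_pow_succ [IsNoetherianRing R] {I : Ideal R} {n : ℕ} {x c : R}
    (hx : x ∈ (I ^ n).intClosure) (hc : c ∈ I) : x * c ∈ (I ^ (n + 1)).intClosure := by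
  obtain ⟨e, he⟩ := exists_pow_mem_of_mem_intClosure hx
  refine mem_intClosure_of_pow_mem (c := e) fun k ↦ ?_
  have h : (I ^ (n + 1)) ^ (k - e) = (I ^ n) ^ (k - e) * I ^ (k - e) := by ring
  rw [mul_pow, h]
  exact mul_mem_mul (he k) (pow_le_pow_right (Nat.sub_le k e) (pow_mem_pow hc k))

theorem intClosure_subset_of_isPrime {J q : Ideal R} [hq : q.IsPrime] (h : J ≤ q) :
    J.intClosure ⊆ q := by
  intro x hx
  obtain ⟨e, he⟩ := mem_intClosure_iff.1 hx
  exact hq.mem_of_pow_mem _ (h (mul_le_left he))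

theorem exists_mul_mem_intClosure_of_localization {J p : Ideal R} [p.IsPrime] {x : R}
    (hx : algebraMap R (Localization.AtPrime p) x ∈
      (J.map (algebraMap R (Localization.AtPrime p))).intClosure) :
    ∃ s ∉ p, s * x ∈ J.intClosure := by
  obtain ⟨e, he⟩ := mem_intClosure_iff.1 hx
  rw [← Set.image_singleton, ← map_span, ← map_sup, ← Ideal.map_pow, ← Ideal.map_mul, ← map_pow,
    IsLocalization.algebraMap_mem_map_algebraMap_iff p.primeCompl] at he
  obtain ⟨s, hs, h⟩ := he
  refine ⟨s, hs, mem_intClosure_iff.2 ⟨e, ?_⟩⟩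
  have h1 : span {s} ^ e * (J * (J ⊔ span {x}) ^ e) ≤ J * (J ⊔ span {s * x}) ^ e := by
    calc span {s} ^ e * (J * (J ⊔ span {x}) ^ e)
        = J * (span {s} * J ⊔ span {s} * span {x}) ^ e := by rw [← mul_sup, mul_pow]; ring
      _ ≤ J * (J ⊔ span {s * x}) ^ e := by
        rw [span_singleton_mul_span_singleton]
        gcongr
        exact mul_le_right
  refine h1 ?_
  rw [show (s * x) ^ (e + 1) = s ^ e * (s * x ^ (e + 1)) by ring]
  exact mul_mem_mul (pow_mem_pow (mem_span_singleton_self s) e) h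

end Ideal

section Rees

open Polynomial

namespace Ideal

variable {R : Type} [CommRing R]

/-- The extension of `I` to its Rees algebra, whose quotient is the associated graded ring. -/
noncomputable abbrev reesExtension (I : Ideal R) : Ideal (reesAlgebra I) :=
  I.map (algebraMap R (reesAlgebra I))

theorem coeff_mem_of_mem_reesExtension {I : Ideal R} {f : reesAlgebra I}
    (hf : f ∈ I.reesExtension) (j : ℕ) : (f : R[X]).coeff j ∈ I ^ (j + 1) := by
  induction hf using Submodule.span_induction generalizing j with
  | mem f hf =>
    obtain ⟨a, ha, rfl⟩ := hf
    change (C a).coeff j ∈ _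
    rw [coeff_C]
    split_ifs with h
    · simpa [h] using ha
    · exact zero_mem _
  | zero => simp
  | add f g _ _ hf hg => simpa using add_mem (hf j) (hg j)
  | smul b f _ hf =>
    change ((b : R[X]) * (f : R[X])).coeff j ∈ _
    rw [coeff_mul]
    refine sum_mem _ fun i hi ↦ ?_
    rw [← Finset.HasAntidiagonal.mem_antidiagonal.1 hi, add_assoc, pow_add]
    exact mul_mem_mul (b.2 i.1) (hf i.2)

theorem monomial_mem_reesExtension {I : Ideal R} {j : ℕ} {z : R} (hz : z ∈ I ^ (j + 1)) :
    (⟨monomial j z, reesAlgebra.monomial_mem.2 (pow_le_pow_right j.le_succ hz)⟩ :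
      reesAlgebra I) ∈ I.reesExtension := by
  suffices h : ∃ h : monomial j z ∈ reesAlgebra I,
      (⟨monomial j z, h⟩ : reesAlgebra I) ∈ I.reesExtension from h.2
  rw [pow_succ'] at hz
  induction hz using Submodule.mul_induction_on' with
  | mem_mul_mem a ha b hb =>
    have hb' := reesAlgebra.monomial_mem.2 hb
    have h := mul_mem_right (⟨monomial j b, hb'⟩ : reesAlgebra I) _
      (mem_map_of_mem (algebraMap R (reesAlgebra I)) ha)
    have e : ((algebraMap R (reesAlgebra I) a * ⟨monomial j b, hb'⟩ : reesAlgebra I) : R[X]) =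
        monomial j (a * b) := C_mul_monomial
    exact ⟨e ▸ Subtype.property _, by convert h using 1; exact Subtype.ext e.symm⟩
  | add x _ y _ hx hy =>
    obtain ⟨hx, hx'⟩ := hx
    obtain ⟨hy, hy'⟩ := hy
    refine ⟨by rw [map_add]; exact add_mem hx hy, ?_⟩
    convert add_mem hx' hy' using 1
    exact Subtype.ext (map_add _ _ _)

/-- The associated primes of the `A`-module `A ⧸ K`. -/
def quotientAssociatedPrimes {A : Type} [CommRing A] (K : Ideal A) : Set (Ideal A) :=
  associatedPrimes A (A ⧸ K)

/-- Contractions to `R` of the associated primes of the associated graded ring of `I`. -/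
def gradedAssociatedPrimes (I : Ideal R) : Set (Ideal R) :=
  comap (algebraMap R (reesAlgebra I)) ''
    I.reesExtension.quotientAssociatedPrimes

theorem finite_quotientAssociatedPrimes {A : Type} [CommRing A] [IsNoetherianRing A]
    (K : Ideal A) : K.quotientAssociatedPrimes.Finite :=
  associatedPrimes.finite A (A ⧸ K)

theorem finite_gradedAssociatedPrimes [IsNoetherianRing R] (I : Ideal R) :
    I.gradedAssociatedPrimes.Finite :=
  (finite_quotientAssociatedPrimes _).image _

theorem minimalPrimes_colon_singleton_subset_quotientAssociatedPrimes {A : Type} [CommRing A]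
    [IsNoetherianRing A] (K : Ideal A) (g : A) :
    (K.colon {g}).minimalPrimes ⊆ K.quotientAssociatedPrimes := by
  have h : K.colon {g} = Module.annihilator A (A ∙ (Submodule.Quotient.mk g : A ⧸ K)) := by
    ext r
    rw [← Submodule.annihilator, Submodule.mem_annihilator_span_singleton,
      ← Submodule.Quotient.mk_smul, Submodule.Quotient.mk_eq_zero, Submodule.mem_colon_singleton]
  rw [h]
  exact (Module.associatedPrimes.minimalPrimes_annihilator_subset_associatedPrimes _ _).trans
    (associatedPrimes.subset_of_injective (Submodule.injective_subtype _))

theorem minimalPrimes_colon_subset_gradedAssociatedPrimes [IsNoetherianRing R] {I : Ideal R}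
    {j : ℕ} {z : R} (hz : z ∈ I ^ j) :
    ((I ^ (j + 1)).colon {z}).minimalPrimes ⊆ I.gradedAssociatedPrimes := by
  intro p hp
  let g : reesAlgebra I := ⟨monomial j z, reesAlgebra.monomial_mem.2 hz⟩
  have hg (r : R) : ((algebraMap R (reesAlgebra I) r * g : reesAlgebra I) : R[X]) =
      monomial j (r * z) := C_mul_monomial
  have h : (I ^ (j + 1)).colon {z} =
      (I.reesExtension.colon {g}).comap (algebraMap R (reesAlgebra I)) := by
    ext r
    rw [mem_comap, Submodule.mem_colon_singleton, Submodule.mem_colon_singleton, smul_eq_mul,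
      smul_eq_mul]
    constructor
    · intro hr
      convert monomial_mem_reesExtension hr using 1
      exact Subtype.ext (hg r)
    · intro hr
      have := coeff_mem_of_mem_reesExtension hr j
      rwa [hg, coeff_monomial_same] at this
  rw [h] at hp
  obtain ⟨Q, hQ, rfl⟩ := exists_minimalPrimes_comap_eq _ _ hp
  exact ⟨Q, minimalPrimes_colon_singleton_subset_quotientAssociatedPrimes _ _ hQ, rfl⟩

theorem exists_mul_mem_pow_of_notMem_gradedAssociatedPrimes [IsNoetherianRing R] {I p : Ideal R}
    [hp : p.IsPrime] (hpI : p ∉ I.gradedAssociatedPrimes) {m : ℕ} {y : R}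
    (h : p ≤ ((I ^ m).colon {y}).radical) : ∃ s ∉ p, s * y ∈ I ^ m := by
  suffices ∀ j ≤ m, ∃ s ∉ p, s * y ∈ I ^ j from this m le_rfl
  intro j
  induction j with
  | zero => exact fun _ ↦ ⟨1, p.one_notMem, by simp⟩
  | succ j ih =>
    intro hj
    obtain ⟨s, hs, hsy⟩ := ih (by omega)
    by_contra! hcon
    refine hpI (minimalPrimes_colon_subset_gradedAssociatedPrimes hsy ⟨⟨hp, fun r hr ↦ ?_⟩, ?_⟩)
    · rw [Submodule.mem_colon_singleton, smul_eq_mul, ← mul_assoc] at hr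
      by_contra hrp
      exact hcon (r * s) (hp.mul_notMem hrp hs) hr
    · rintro q ⟨hq, hle⟩ -
      refine h.trans (hq.radical_le_iff.2 (le_trans (fun r hr ↦ ?_) hle))
      rw [Submodule.mem_colon_singleton, smul_eq_mul] at hr ⊢
      rw [mul_left_comm]
      exact mul_mem_left _ _ (pow_le_pow_right hj hr)

end Ideal

end Rees

namespace Ideal

variable {R : Type} [CommRing R]

theorem mem_gradedAssociatedPrimes_of_eq_colon [IsNoetherianRing R] {I p : Ideal R}
    [p.IsPrime] {n : ℕ} {x : R} (hp : (p : Set R) = {r | r * x ∈ (I ^ n).intClosure}) :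
    p ∈ I.gradedAssociatedPrimes := by
  by_contra hpI
  have hmem (r : R) : r ∈ p ↔ r * x ∈ (I ^ n).intClosure := by
    rw [← SetLike.mem_coe, hp, Set.mem_ofPred_eq]
  obtain ⟨S, hS⟩ := IsNoetherian.noetherian p
  have hSp : ∀ r ∈ S, r ∈ p := fun r hr ↦ hS ▸ Submodule.subset_span hr
  choose! c hc using fun r (hr : r ∈ S) ↦
    exists_pow_mem_of_mem_intClosure ((hmem r).1 (hSp r hr))
  let C := S.sup c
  have key : ∀ k, ∃ s ∉ p, s * x ^ k ∈ (I ^ n) ^ (k - C) := fun k ↦ by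
    rw [← pow_mul]
    refine exists_mul_mem_pow_of_notMem_gradedAssociatedPrimes hpI ?_
    rw [← hS]
    refine Submodule.span_le.2 fun r hr ↦ ⟨k, ?_⟩
    rw [Submodule.mem_colon_singleton, smul_eq_mul, ← mul_pow, pow_mul]
    exact pow_le_pow_right (Nat.sub_le_sub_left (Finset.le_sup hr) k) (hc r hr k)
  obtain ⟨s, hs, hsx⟩ := exists_mul_mem_intClosure_of_localization (J := I ^ n) (p := p) (x := x) <|
    mem_intClosure_of_pow_mem (c := C) fun k ↦ by
      rw [← Ideal.map_pow, ← map_pow,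
        IsLocalization.algebraMap_mem_map_algebraMap_iff p.primeCompl]
      exact key k
  exact hs ((hmem s).2 hsx)

theorem exists_notMem_forall_mem_minimalPrimes [IsNoetherianRing R] (p : Ideal R) [p.IsPrime] :
    ∃ t ∉ p, ∀ q ∈ minimalPrimes R, ¬ q ≤ p → t ∈ q := by
  classical
  have hfin := minimalPrimes.finite_of_isNoetherianRing R
  choose! f hf hfp using fun (q : Ideal R) (hq : ¬ q ≤ p) ↦ SetLike.not_le_iff_exists.1 hq
  refine ⟨∏ q ∈ hfin.toFinset with ¬ q ≤ p, f q, fun h ↦ ?_, fun q hq hqp ↦ ?_⟩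
  · obtain ⟨q, hq, hfq⟩ := (IsPrime.prod_mem_iff (p := p)).1 h
    exact hfp q (Finset.mem_filter.1 hq).2 hfq
  · exact mem_of_dvd _ (Finset.dvd_prod_of_mem f (by simp [hq, hqp])) (hf q hqp)

theorem isNilpotent_iff_forall_mem_minimalPrimes {x : R} :
    IsNilpotent x ↔ ∀ q ∈ minimalPrimes R, x ∈ q := by
  rw [← mem_nilradical, nilradical, ← sInf_minimalPrimes, mem_sInf]
  rfl

theorem mem_intClosure_of_pow_succ_sub_isNilpotent {J : Ideal R} {x u : R} {k : ℕ}
    (hu : u ∈ J * (J ⊔ span {x}) ^ k) (h : IsNilpotent (x ^ (k + 1) - u)) :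
    x ∈ J.intClosure := by
  obtain ⟨l, hl⟩ := h
  have hx : x ∈ J ⊔ span {x} := mem_sup_right (mem_span_singleton_self x)
  have huD : u ∈ (J ⊔ span {x}) ^ (k + 1) := by
    rw [pow_succ']
    exact mul_mono_left le_sup_left hu
  rcases l with _ | l
  · have := subsingleton_of_zero_eq_one (hl.symm.trans (pow_zero _))
    exact mem_intClosure_of_isNilpotent ⟨1, Subsingleton.elim _ _⟩
  refine mem_intClosure_iff.2 ⟨(k + 1) * (l + 1) - 1, ?_⟩
  have h1 : (k + 1) * (l + 1) - 1 = k + (k + 1) * l := by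
    rw [Nat.sub_eq_iff_eq_add (Nat.succ_le_of_lt (by positivity))]; ring
  have h2 : x ^ (k + (k + 1) * l + 1) = (x ^ (k + 1)) ^ (l + 1) - (x ^ (k + 1) - u) ^ (l + 1) := by
    rw [hl, sub_zero]; ring
  rw [h1, h2, ← (Commute.all _ _).mul_geom_sum₂, sub_sub_cancel, pow_add, ← mul_assoc]
  refine mul_mem_mul hu (sum_mem _ fun i hi ↦ ?_)
  have hi' := Finset.mem_range.1 hi
  rw [show (k + 1) * l = (k + 1) * i + (k + 1) * (l + 1 - 1 - i) by
    rw [← mul_add]; congr 1; omega, pow_add, pow_mul, pow_mul]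
  exact mul_mem_mul (pow_mem_pow (pow_mem_pow hx _) _)
    (pow_mem_pow (sub_mem (pow_mem_pow hx _) huD) _)

theorem exists_pow_sub_mem_annihilator {N : Type} [AddCommGroup N] [Module R N]
    [Module.Finite R N] {J : Ideal R} {x : R}
    (h : ∀ m : N, x • m ∈ J • (⊤ : Submodule R N)) :
    ∃ k, ∃ u ∈ J * (J ⊔ span {x}) ^ k, x ^ (k + 1) - u ∈ Module.annihilator R N := by
  obtain ⟨P, hP, -, hcoeff, hPN⟩ :=
    LinearMap.exists_monic_and_natDegree_eq_and_coeff_mem_pow_and_aeval_eq_zero R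
      (algebraMap R (Module.End R N) x) J (by rintro _ ⟨m, rfl⟩; exact h m)
  refine ⟨P.natDegree, -(x * ∑ i ∈ Finset.range P.natDegree, P.coeff i * x ^ i),
    (Submodule.neg_mem_iff _).2 ?_, ?_⟩
  · rw [Finset.mul_sum]
    refine sum_mem _ fun i hi ↦ ?_
    obtain ⟨j, hj⟩ := Nat.exists_eq_add_of_lt (Finset.mem_range.1 hi)
    have hi' := hcoeff i
    rw [hj, add_assoc, Nat.add_sub_cancel_left] at hi'
    have hle : J ^ (j + 1) * (J ⊔ span {x}) ^ (i + 1) ≤ J * (J ⊔ span {x}) ^ P.natDegree := by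
      calc J ^ (j + 1) * (J ⊔ span {x}) ^ (i + 1)
          = J * (J ^ j * (J ⊔ span {x}) ^ (i + 1)) := by ring
        _ ≤ J * ((J ⊔ span {x}) ^ j * (J ⊔ span {x}) ^ (i + 1)) := by
            gcongr; exact le_sup_left
        _ = J * (J ⊔ span {x}) ^ P.natDegree := by rw [hj]; ring
    refine hle ?_
    rw [mul_left_comm, ← pow_succ']
    exact mul_mem_mul hi' (pow_mem_pow (mem_sup_right (mem_span_singleton_self x)) _)
  · rw [Module.mem_annihilator]
    intro m
    have hE : P.eval x = x ^ P.natDegree + ∑ i ∈ Finset.range P.natDegree, P.coeff i * x ^ i := by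
      rw [Polynomial.eval_eq_sum_range, Finset.sum_range_succ, hP.coeff_natDegree, one_mul,
        add_comm]
    have hx : x ^ (P.natDegree + 1) - -(x * ∑ i ∈ Finset.range P.natDegree, P.coeff i * x ^ i) =
        x * P.eval x := by
      rw [hE]; ring
    have h0 : P.eval x • m = 0 := by
      rw [Polynomial.aeval_algebraMap_apply_eq_algebraMap_eval] at hPN
      exact LinearMap.congr_fun hPN m
    rw [hx, mul_smul, h0, smul_zero]

theorem mem_intClosure_of_mul_mem_pow_succ [IsNoetherianRing R] {I : Ideal R} {n : ℕ}
    (hn : n ≠ 0) {x : R} (S : Finset R) (hS : span (S : Set R) = I)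
    (h : ∀ c ∈ S, x * c ∈ (I ^ (n + 1)).intClosure)
    (hx : ∀ q ∈ minimalPrimes R, I ≤ q → x ∈ q) : x ∈ (I ^ n).intClosure := by
  classical
  obtain ⟨hle, e, he⟩ := isReductionOf_sup_span (J := I ^ (n + 1)) (S.image (x * ·)) (by simpa)
  set L := I ^ (n + 1) ⊔ span (S.image (x * ·) : Set R) with hL
  have hxI : span {x} * I ≤ L := by
    rw [← hS, span_mul_span', Set.singleton_mul]
    exact le_sup_of_le_right (span_mono (by simp))
  let W := I * L ^ e
  have hW : span {x} * W ≤ I ^ n * W := by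
    calc span {x} * (I * L ^ e) = span {x} * I * L ^ e := by ring
      _ ≤ L * L ^ e := by gcongr
      _ = L ^ (e + 1) := by ring
      _ ≤ I ^ (n + 1) * L ^ e := he
      _ = I ^ n * (I * L ^ e) := by ring
  obtain ⟨k, u, hu, hv⟩ := exists_pow_sub_mem_annihilator (N := W) (J := I ^ n) (x := x)
    fun w ↦ (Submodule.mem_smul_top_iff _ _ _).2
      (hW (mul_mem_mul (mem_span_singleton_self x) w.2))
  refine mem_intClosure_of_pow_succ_sub_isNilpotent hu
    (isNilpotent_iff_forall_mem_minimalPrimes.2 fun q hq ↦ ?_)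
  have hqp : q.IsPrime := hq.1.1
  by_cases hIq : I ≤ q
  · exact sub_mem (pow_mem_of_mem _ (hx q hq hIq) _ k.succ_pos)
      (hIq (pow_le_self hn (mul_le_left hu)))
  · by_contra hvq
    refine hIq (fun c hc ↦ ?_)
    have hcW : c * (c ^ (n + 1)) ^ e ∈ W :=
      mul_mem_mul hc (pow_mem_pow (mem_sup_left (pow_mem_pow hc _)) _)
    have h0 : (x ^ (k + 1) - u) * (c * (c ^ (n + 1)) ^ e) = 0 :=
      congrArg Subtype.val (Module.mem_annihilator.1 hv ⟨_, hcW⟩)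
    have := (hqp.mem_or_mem (h0 ▸ zero_mem q)).resolve_left hvq
    rw [← pow_mul, ← pow_succ'] at this
    exact hqp.mem_of_pow_mem _ this

end Ideal

namespace Ideal

variable {R : Type} [CommRing R] {N : Type} [AddCommGroup N] [Module R N]

theorem mul_mem_relIntClosure_pow_succ {I : Ideal R} {n : ℕ} {x c : R}
    (hx : x ∈ (I ^ n).relIntClosure N) (hc : c ∈ I) : x * c ∈ (I ^ (n + 1)).relIntClosure N := by
  obtain ⟨k, hk, h⟩ := hx
  refine ⟨k, hk, fun m ↦ ?_⟩
  have hle : (⨆ i ∈ Finset.Icc 1 k, x ^ (k - i) • ((I ^ n) ^ i • (⊤ : Submodule R N))) ≤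
      (⨆ i ∈ Finset.Icc 1 k, (x * c) ^ (k - i) • ((I ^ (n + 1)) ^ i • (⊤ : Submodule R N))).comap
        (LinearMap.lsmul R N (c ^ k)) := by
    refine iSup₂_le fun i hi z hz ↦ ?_
    obtain ⟨w, hw, rfl⟩ := (Submodule.mem_smul_pointwise_iff_exists _ _ _).1 hz
    refine Submodule.mem_iSup_of_mem i (Submodule.mem_iSup_of_mem hi ?_)
    have hcw : c ^ i • w ∈ (I ^ (n + 1)) ^ i • (⊤ : Submodule R N) := by
      rw [pow_succ, mul_pow, mul_comm, Submodule.mul_smul]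
      exact Submodule.smul_mem_smul (pow_mem_pow hc i) hw
    convert Submodule.smul_mem_pointwise_smul _ ((x * c) ^ (k - i)) _ hcw using 1
    rw [LinearMap.lsmul_apply, smul_smul, smul_smul, ← pow_sub_mul_pow c (Finset.mem_Icc.1 hi).2]
    ring_nf
  rw [mul_pow, mul_comm (x ^ k), mul_smul]
  exact hle (h m)

theorem mem_relIntClosure_of_mem_annihilator {J : Ideal R} {x : R}
    (hx : x ∈ Module.annihilator R N) : x ∈ J.relIntClosure N :=
  ⟨1, one_pos, fun m ↦ by simp [Module.mem_annihilator.1 hx m]⟩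

theorem relIntClosure_subset_of_isPrime [Module.Finite R N] {J q : Ideal R} [hq : q.IsPrime]
    (hJ : J ≤ q) (hN : Module.annihilator R N ≤ q) : J.relIntClosure N ⊆ q := by
  rintro x ⟨n, hn, h⟩
  have hle : (⨆ i ∈ Finset.Icc 1 n, x ^ (n - i) • (J ^ i • (⊤ : Submodule R N))) ≤
      J • (⊤ : Submodule R N) := by
    refine iSup₂_le fun i hi ↦ (Submodule.smul_le_self_of_tower _ _).trans ?_
    exact Submodule.smul_mono_left (pow_le_self (by have := Finset.mem_Icc.1 hi; omega))
  obtain ⟨k, u, hu, hv⟩ := exists_pow_sub_mem_annihilator fun m ↦ hle (h m)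
  exact hq.mem_of_pow_mem _ <| hq.mem_of_pow_mem _ <|
    (q.sub_mem_iff_left (hJ (mul_le_left hu))).1 (hN hv)

theorem exists_notMem_mul_mem_intClosure [IsNoetherianRing R] {q : Ideal R}
    (hq : q ∈ minimalPrimes R) (J : Ideal R) :
    ∃ t ∉ q, ∀ r ∈ q, r * t ∈ J.intClosure := by
  have hqp : q.IsPrime := hq.1.1
  obtain ⟨t, ht, h⟩ := exists_notMem_forall_mem_minimalPrimes q
  refine ⟨t, ht, fun r hr ↦ mem_intClosure_of_isNilpotent
    (isNilpotent_iff_forall_mem_minimalPrimes.2 fun q' hq' ↦ ?_)⟩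
  by_cases hle : q' ≤ q
  · exact mul_mem_right _ _ (hq.2 hq'.1 hle hr)
  · exact mul_mem_left _ _ (h q' hq' hle)

theorem assQuot₂_pow_subset_pow_succ [IsNoetherianRing R] [Module.Finite R N] (I : Ideal R)
    {n : ℕ} (hn : n ≠ 0) :
    assQuot₂ ((I ^ n).relIntClosure N) ((I ^ n).intClosure) ⊆
      assQuot₂ ((I ^ (n + 1)).relIntClosure N) ((I ^ (n + 1)).intClosure) := by
  rintro p ⟨hp, x, hxN, hpx⟩
  have hmem (r : R) : r ∈ p ↔ r * x ∈ (I ^ n).intClosure := by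
    rw [← SetLike.mem_coe, hpx, Set.mem_ofPred_eq]
  refine ⟨hp, ?_⟩
  by_cases hmin : ∃ q ∈ minimalPrimes R, q ≤ p ∧ I ≤ q ∧ x ∉ q
  · obtain ⟨q, hq, hqp, hIq, hxq⟩ := hmin
    have hq' : q.IsPrime := hq.1.1
    obtain rfl : p = q := le_antisymm (fun r hr ↦ (hq'.mem_or_mem (intClosure_subset_of_isPrime
      ((pow_le_self hn).trans hIq) ((hmem r).1 hr))).resolve_right hxq) hqp
    obtain ⟨a, ha, hap⟩ := SetLike.not_le_iff_exists.1 fun hN ↦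
      hxq (relIntClosure_subset_of_isPrime ((pow_le_self hn).trans hIq) hN hxN)
    obtain ⟨t, ht, htp⟩ := exists_notMem_mul_mem_intClosure hq (I ^ (n + 1))
    refine ⟨a * t, mem_relIntClosure_of_mem_annihilator (mul_mem_right _ _ ha),
      Set.Subset.antisymm (fun r hr ↦ ?_) fun r hr ↦ ?_⟩
    · rw [Set.mem_ofPred_eq, mul_left_comm]
      exact mul_mem_intClosure a (htp r hr)
    · exact (hq'.mem_or_mem (intClosure_subset_of_isPrime
        ((pow_le_self n.succ_ne_zero).trans hIq) hr)).resolve_right (hp.mul_notMem hap ht)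
  · push Not at hmin
    obtain ⟨S, hS⟩ := IsNoetherian.noetherian I
    have hSI : ∀ c ∈ S, c ∈ I := fun c hc ↦ hS ▸ Submodule.subset_span hc
    suffices ∃ c ∈ S, ∀ s, s * (x * c) ∈ (I ^ (n + 1)).intClosure → s ∈ p by
      obtain ⟨c, hc, hcp⟩ := this
      refine ⟨x * c, mul_mem_relIntClosure_pow_succ hxN (hSI c hc),
        Set.Subset.antisymm (fun r hr ↦ ?_) hcp⟩
      rw [Set.mem_ofPred_eq, ← mul_assoc]
      exact mul_mem_intClosure_pow_succ ((hmem r).1 hr) (hSI c hc)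
    by_contra! hcon
    choose! s hs hsp using hcon
    obtain ⟨t, ht, htq⟩ := exists_notMem_forall_mem_minimalPrimes p
    have hprod : (t * ∏ c ∈ S, s c) ∉ p :=
      hp.mul_notMem ht fun h ↦ by
        obtain ⟨c, hc, hcp⟩ := hp.prod_mem_iff.1 h
        exact hsp c hc hcp
    refine hprod ((hmem _).2 (mem_intClosure_of_mul_mem_pow_succ hn S hS (fun c hc ↦ ?_)
      fun q hq hIq ↦ ?_))
    · obtain ⟨d, hd⟩ := Finset.dvd_prod_of_mem s hc
      rw [hd, show t * (s c * d) * x * c = t * d * (s c * (x * c)) by ring]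
      exact mul_mem_intClosure _ (hs c hc)
    · by_cases hqp : q ≤ p
      · exact mul_mem_left _ _ (hmin q hq hqp hIq)
      · exact mul_mem_right _ _ (mul_mem_right _ _ (htq q hq hqp))

end Ideal

theorem Set.Finite.exists_forall_ge_eq_of_monotone {α : Type*} {F : Set α} (hF : F.Finite)
    {f : ℕ → Set α} (hf : Monotone f) (hfF : ∀ n, f n ⊆ F) : ∃ n₀, ∀ n, n₀ ≤ n → f n = f n₀ := by
  have hu : (⋃ n, f n).Finite := hF.subset (Set.iUnion_subset hfF)
  obtain ⟨n₀, h⟩ := hf.directed_le.exists_mem_subset_of_finset_subset_biUnion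
    (s := hu.toFinset) (by simp)
  rw [hu.coe_toFinset] at h
  exact ⟨n₀, fun n hn ↦ Set.Subset.antisymm ((Set.subset_iUnion f n).trans h) (hf hn)⟩

/-- Over a Noetherian ring, the sequence `Ass_R (I^n)^{(N)}_a/(I^n)_a`, `n ≥ 1`, is increasing
and ultimately constant. -/
theorem assQuot₂_relIntClosure_intClosure_pow {R : Type} [CommRing R] [IsNoetherianRing R]
    (N : Type) [AddCommGroup N] [Module R N] [Module.Finite R N] (I : Ideal R)
    (hI : ∀ p ∈ (Module.annihilator R N).minimalPrimes, ¬ I ≤ p) :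
    (∀ n : ℕ, 1 ≤ n →
      assQuot₂ ((I ^ n).relIntClosure N) ((I ^ n).intClosure) ⊆
        assQuot₂ ((I ^ (n + 1)).relIntClosure N) ((I ^ (n + 1)).intClosure)) ∧
    ∃ n₀ : ℕ, 1 ≤ n₀ ∧ ∀ n : ℕ, n₀ ≤ n →
      assQuot₂ ((I ^ n).relIntClosure N) ((I ^ n).intClosure) =
        assQuot₂ ((I ^ n₀).relIntClosure N) ((I ^ n₀).intClosure) := by
  have hmono : Monotone fun n ↦
      assQuot₂ ((I ^ (n + 1)).relIntClosure N) ((I ^ (n + 1)).intClosure) :=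
    monotone_nat_of_le_succ fun n ↦ I.assQuot₂_pow_subset_pow_succ n.succ_ne_zero
  refine ⟨fun n hn ↦ I.assQuot₂_pow_subset_pow_succ (Nat.ne_of_gt hn), ?_⟩
  obtain ⟨n₀, h⟩ := I.finite_gradedAssociatedPrimes.exists_forall_ge_eq_of_monotone hmono
    fun n p ⟨hp, x, _, hpx⟩ ↦ Ideal.mem_gradedAssociatedPrimes_of_eq_colon hpx
  refine ⟨n₀ + 1, Nat.le_add_left 1 n₀, fun n hn ↦ ?_⟩
  obtain ⟨m, rfl⟩ := Nat.exists_eq_add_of_le' (show 1 ≤ n by omega)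
  exact h m (by omega)
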